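/- For every nonnegative trigonometric polynomial p of degree at most n (n a positive integer): ∫_{-π}^{π} p(θ)² dθ ≤ ((2n+1)/(2π)) · (∫_{-π}^{π} p(θ) dθ)². -/

import Mathlib

open MeasureTheory Real Set

noncomputable section

/-- A trigonometric polynomial of degree at most `n`. -/
def IsTrigPoly (n : ℕ) (p : ℝ → ℝ) : Prop :=
  ∃ a b : ℕ → ℝ, ∀ θ : ℝ,
    p θ = a 0 + ∑ k ∈ Finset.Icc 1 n, (a k * Real.cos (k * θ) + b k * Real.sin (k * θ))

theorem sum_exp_equispaced_eq_zero {k N : ℕ} (hk : 0 < k) (hkN : k < N) (θ : ℝ) :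
    ∑ j ∈ Finset.range N, Complex.exp (((k * (θ + 2 * π * j / N) : ℝ) : ℂ) * Complex.I) = 0 := by
  have hN : N ≠ 0 := by omega
  have hNC : (N : ℂ) ≠ 0 := by exact_mod_cast hN
  have hprim := Complex.isPrimitiveRoot_exp N hN
  set ζ := Complex.exp (2 * π * Complex.I / N) with hζ
  have hne : ζ ^ k ≠ 1 := hprim.pow_ne_one_of_pos_of_lt hk.ne' hkN
  have hgeom : ∑ j ∈ Finset.range N, (ζ ^ k) ^ j = 0 := by
    rw [geom_sum_eq hne, pow_right_comm, hprim.pow_eq_one, one_pow, sub_self, zero_div]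
  calc
    _ = ∑ j ∈ Finset.range N, Complex.exp (k * θ * Complex.I) * (ζ ^ k) ^ j := by
      refine Finset.sum_congr rfl fun j _ => ?_
      rw [← pow_mul, hζ, ← Complex.exp_nat_mul, ← Complex.exp_add]
      congr 1
      push_cast
      field_simp
    _ = 0 := by rw [← Finset.mul_sum, hgeom, mul_zero]

theorem sum_cos_equispaced_eq_zero {k N : ℕ} (hk : 0 < k) (hkN : k < N) (θ : ℝ) :
    ∑ j ∈ Finset.range N, Real.cos (k * (θ + 2 * π * j / N)) = 0 := by
  have h := congrArg Complex.re (sum_exp_equispaced_eq_zero hk hkN θ)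
  simpa only [Complex.re_sum, Complex.exp_ofReal_mul_I_re, Complex.zero_re] using h

theorem sum_sin_equispaced_eq_zero {k N : ℕ} (hk : 0 < k) (hkN : k < N) (θ : ℝ) :
    ∑ j ∈ Finset.range N, Real.sin (k * (θ + 2 * π * j / N)) = 0 := by
  have h := congrArg Complex.im (sum_exp_equispaced_eq_zero hk hkN θ)
  simpa only [Complex.im_sum, Complex.exp_ofReal_mul_I_im, Complex.zero_im] using h

theorem IsTrigPoly.continuous {n : ℕ} {p : ℝ → ℝ} (hp : IsTrigPoly n p) : Continuous p := by
  obtain ⟨a, b, h⟩ := hp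
  rw [funext h]
  fun_prop

theorem integral_cos_nat_mul {k : ℕ} (hk : 0 < k) : ∫ θ in (-π)..π, Real.cos (k * θ) = 0 := by
  have hk' : (k : ℝ) ≠ 0 := by exact_mod_cast hk.ne'
  rw [intervalIntegral.integral_comp_mul_left (fun x => Real.cos x) hk', integral_cos]
  simp [Real.sin_nat_mul_pi]

theorem integral_sin_nat_mul (k : ℕ) : ∫ θ in (-π)..π, Real.sin (k * θ) = 0 := by
  rcases Nat.eq_zero_or_pos k with rfl | hk
  · simp
  have hk' : (k : ℝ) ≠ 0 := by exact_mod_cast hk.ne'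
  rw [intervalIntegral.integral_comp_mul_left (fun x => Real.sin x) hk', integral_sin]
  simp

/-- The `N`-point trapezoidal rule is exact on trigonometric polynomials of degree below `N`. -/
theorem IsTrigPoly.sum_equispaced {n N : ℕ} {p : ℝ → ℝ} (hp : IsTrigPoly n p) (hN : n < N)
    (θ : ℝ) :
    ∑ j ∈ Finset.range N, p (θ + 2 * π * j / N) = N / (2 * π) * ∫ x in (-π)..π, p x := by
  obtain ⟨a, b, h⟩ := hp
  have hint : ∫ x in (-π)..π, p x = 2 * π * a 0 := by
    simp_rw [h]
    rw [intervalIntegral.integral_add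
        (Continuous.intervalIntegrable (by fun_prop) _ _)
        (Continuous.intervalIntegrable (by fun_prop) _ _),
      intervalIntegral.integral_finsetSum
        fun k _ => Continuous.intervalIntegrable (by fun_prop) _ _,
      Finset.sum_eq_zero, intervalIntegral.integral_const, smul_eq_mul]
    · ring
    · intro k hk
      rw [intervalIntegral.integral_add
          (Continuous.intervalIntegrable (by fun_prop) _ _)
          (Continuous.intervalIntegrable (by fun_prop) _ _),
        intervalIntegral.integral_const_mul, intervalIntegral.integral_const_mul,
        integral_cos_nat_mul (Finset.mem_Icc.mp hk).1, integral_sin_nat_mul]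
      simp
  have hsum : ∑ j ∈ Finset.range N, p (θ + 2 * π * j / N) = N * a 0 := by
    simp_rw [h]
    rw [Finset.sum_add_distrib, Finset.sum_comm, Finset.sum_eq_zero (s := Finset.Icc 1 n)]
    · simp
    · intro k hk
      obtain ⟨hk1, hkn⟩ := Finset.mem_Icc.mp hk
      rw [Finset.sum_add_distrib, ← Finset.mul_sum, ← Finset.mul_sum,
        sum_cos_equispaced_eq_zero hk1 (by omega), sum_sin_equispaced_eq_zero hk1 (by omega)]
      simp
  rw [hsum, hint]
  field_simp

theorem IsTrigPoly.le_integral {n N : ℕ} {p : ℝ → ℝ} (hp : IsTrigPoly n p) (hN : n < N)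
    (hp0 : ∀ θ, 0 ≤ p θ) (θ : ℝ) : p θ ≤ N / (2 * π) * ∫ x in (-π)..π, p x := by
  rw [← hp.sum_equispaced hN θ]
  have h := Finset.single_le_sum (f := fun j : ℕ => p (θ + 2 * π * j / N))
    (fun j _ => hp0 _) (Finset.mem_range.mpr (Nat.zero_lt_of_lt hN))
  simpa using h

theorem square_integral_bound (n : ℕ) (hn : 1 ≤ n)
    (p : ℝ → ℝ) (hp : IsTrigPoly n p) (hp0 : ∀ θ, 0 ≤ p θ) :
    (∫ θ in (-π)..π, (p θ) ^ 2) ≤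
      ((2 * n + 1) / (2 * π)) * (∫ θ in (-π)..π, p θ) ^ 2 := by
  have hc := hp.continuous
  have hsup := hp.le_integral (N := 2 * n + 1) (by omega) hp0
  push_cast at hsup
  set I := ∫ θ in (-π)..π, p θ with hI
  calc
    _ ≤ ∫ θ in (-π)..π, (2 * n + 1) / (2 * π) * I * p θ := by
      refine intervalIntegral.integral_mono_on (by linarith [Real.pi_pos])
        ((hc.pow 2).intervalIntegrable _ _)
        ((continuous_const.mul hc).intervalIntegrable _ _) fun θ _ => ?_
      rw [sq]
      exact mul_le_mul_of_nonneg_right (hsup θ) (hp0 θ)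
    _ = _ := by
      rw [intervalIntegral.integral_const_mul, ← hI]
      ring
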